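/- arXiv:1905.09303 — 2 statements merged into one kernel-verified Lean document; each statement's English description precedes it below -/
import Mathlib

section
/- Let H(n) = ∑_{M ∈ M_{n,q}} μ²(M)·3^{ω(M)}/|M|, the sum over monic polynomials M of degree n over F_q. Then there is an absolute constant c_1 > 0 (depending only on q) such that H(n) ≥ c_1·n² for all n ≥ 1. -/
open scoped Classical
open Polynomial

/-- `ω(M)`: the number of distinct monic irreducible factors of `M`. -/
noncomputable def omegaPoly {Fq : Type*} [Field Fq] (M : Polynomial Fq) : ℕ :=
  (UniqueFactorizationMonoid.normalizedFactors M).toFinset.card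

section

variable {F : Type*} [Field F] [Fintype F]

theorem monSet_finite (n : ℕ) : {M : F[X] | M.Monic ∧ M.natDegree = n}.Finite := by
  have : Finite {p : F[X] // p.Monic ∧ p.natDegree = n} :=
    Finite.of_equiv _ ((monicEquivDegreeLT (R := F) n).trans (degreeLTEquiv F n).toEquiv).symm
  exact Set.finite_coe_iff.mp this

theorem monSet_ncard (n : ℕ) :
    {M : F[X] | M.Monic ∧ M.natDegree = n}.ncard = Fintype.card F ^ n := by
  have := Nat.card_congr ((monicEquivDegreeLT (R := F) n).trans (degreeLTEquiv F n).toEquiv)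
  rw [← Nat.card_coe_set_eq]
  refine this.trans ?_
  simp

variable (F) in
noncomputable def monF (n : ℕ) : Finset F[X] := (monSet_finite (F := F) n).toFinset

theorem mem_monF {n : ℕ} {M : F[X]} : M ∈ monF F n ↔ M.Monic ∧ M.natDegree = n := by
  simp [monF]

theorem card_monF (n : ℕ) : (monF F n).card = Fintype.card F ^ n := by
  rw [← monSet_ncard, monF, Set.ncard_eq_toFinset_card _ (monSet_finite (F := F) n)]

variable (F) in
noncomputable def monL (N : ℕ) : Finset F[X] := (Finset.range (N + 1)).biUnion (monF F)

theorem mem_monL {n : ℕ} {M : F[X]} : M ∈ monL F n ↔ M.Monic ∧ M.natDegree ≤ n := by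
  simp [monL, mem_monF]
  tauto

noncomputable def wt (M : F[X]) : ℝ := ((Fintype.card F : ℝ) ^ M.natDegree)⁻¹

theorem wt_pos (M : F[X]) : 0 < wt M := by
  have : 0 < Fintype.card F := Fintype.card_pos
  unfold wt; positivity

theorem wt_mul {A B : F[X]} (hA : A.Monic) (hB : B.Monic) : wt (A * B) = wt A * wt B := by
  unfold wt
  rw [hA.natDegree_mul hB, pow_add, mul_inv]

theorem sum_monL (N : ℕ) (f : F[X] → ℝ) :
    ∑ M ∈ monL F N, f M = ∑ d ∈ Finset.range (N + 1), ∑ M ∈ monF F d, f M := by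
  rw [monL, Finset.sum_biUnion]
  intro i _ j _ hij
  rw [Function.onFun, Finset.disjoint_left]
  intro a ha hb
  rw [mem_monF] at ha hb
  exact hij (ha.2.symm.trans hb.2)

theorem two_le_card : 2 ≤ Fintype.card F := Fintype.one_lt_card

theorem sum_wt (N : ℕ) : ∑ M ∈ monL F N, wt M = N + 1 := by
  rw [sum_monL]
  have h0 : (Fintype.card F : ℝ) ≠ 0 := by
    have := two_le_card (F := F); positivity
  have : ∀ d ∈ Finset.range (N + 1), ∑ M ∈ monF F d, wt M = 1 := by
    intro d _
    rw [Finset.sum_congr rfl (g := fun _ => ((Fintype.card F : ℝ) ^ d)⁻¹)]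
    · rw [Finset.sum_const, card_monF, nsmul_eq_mul]
      push_cast
      field_simp
    · intro M hM
      rw [mem_monF] at hM
      rw [wt, hM.2]
  rw [Finset.sum_congr rfl this]
  simp

theorem sum_wt_sq (N : ℕ) : ∑ M ∈ monL F N, wt M ^ 2 ≤ 2 := by
  rw [sum_monL]
  have h2 : (2 : ℝ) ≤ (Fintype.card F : ℝ) := by exact_mod_cast two_le_card (F := F)
  have h0 : (Fintype.card F : ℝ) ≠ 0 := by positivity
  have : ∀ d ∈ Finset.range (N + 1), ∑ M ∈ monF F d, wt M ^ 2 ≤ (1 / 2 : ℝ) ^ d := by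
    intro d _
    rw [Finset.sum_congr rfl (g := fun _ => (((Fintype.card F : ℝ) ^ d)⁻¹) ^ 2)]
    · rw [Finset.sum_const, card_monF, nsmul_eq_mul]
      have : ((Fintype.card F ^ d : ℕ) : ℝ) * (((Fintype.card F : ℝ) ^ d)⁻¹) ^ 2
        = (1 / (Fintype.card F : ℝ)) ^ d := by
        rw [one_div, inv_pow _ d, sq, ← mul_assoc]
        push_cast
        rw [mul_inv_cancel₀ (pow_ne_zero _ h0), one_mul]
      rw [this]
      gcongr
    · intro M hM
      rw [mem_monF] at hM
      rw [wt, hM.2]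
  refine (Finset.sum_le_sum this).trans ?_
  exact sum_geometric_two_le _

/-- squarefree part decomposition -/
theorem exists_sq_mul (A : F[X]) (hA : A.Monic) :
    ∃ a s : F[X], a.Monic ∧ s.Monic ∧ Squarefree a ∧ A = a * (s * s) := by
  induction h : A.natDegree using Nat.strong_induction_on generalizing A with
  | _ n ih =>
    by_cases hs : Squarefree A
    · exact ⟨A, 1, hA, monic_one, hs, by simp⟩
    · unfold Squarefree at hs
      push Not at hs
      obtain ⟨x, ⟨y, hy⟩, hx⟩ := hs
      have hx0 : x ≠ 0 := by rintro rfl; simp at hy; exact hA.ne_zero hy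
      set u := normalize x with hu
      have hum : u.Monic := monic_normalize hx0
      have hua : Associated u x := normalize_associated x
      have hdvd : u * u ∣ A := by
        rw [hy]; exact (mul_dvd_mul hua.dvd hua.dvd).mul_right y
      obtain ⟨z, hz⟩ := hdvd
      have hzm : z.Monic := (hum.mul hum).of_mul_monic_left (hz ▸ hA)
      have hud : 0 < u.natDegree := by
        rw [Nat.pos_iff_ne_zero]
        intro h0
        apply hx
        rw [← hua.isUnit_iff, hum.natDegree_eq_zero.mp h0]
        exact isUnit_one
      have hd : z.natDegree < n := by
        rw [← h, hz, (hum.mul hum).natDegree_mul hzm, hum.natDegree_mul hum]; omega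
      obtain ⟨a, s, ha, hs, hsq, e⟩ := ih _ hd z hzm rfl
      exact ⟨a, u * s, ha, hum.mul hs, hsq, by rw [hz, e]; ring⟩

theorem exists_gcd (A B : F[X]) (hA : A.Monic) (hB : B.Monic) :
    ∃ x a b : F[X], x.Monic ∧ a.Monic ∧ b.Monic ∧ IsRelPrime a b ∧ A = x * a ∧ B = x * b := by
  obtain ⟨a', b', c, hrp, ha, hb⟩ :=
    UniqueFactorizationMonoid.exists_reduced_factors A hA.ne_zero B
  have hc0 : c ≠ 0 := by rintro rfl; simp at ha; exact hA.ne_zero ha.symm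
  have hum : (normalize c).Monic := monic_normalize hc0
  have hua : Associated (normalize c) c := normalize_associated c
  obtain ⟨a, ea⟩ : normalize c ∣ A := hua.dvd.trans ⟨a', ha.symm⟩
  obtain ⟨b, eb⟩ : normalize c ∣ B := hua.dvd.trans ⟨b', hb.symm⟩
  have h1 : Associated a a' :=
    Associated.of_mul_left (Associated.of_eq (by rw [← ea, ha])) hua hum.ne_zero
  have h2 : Associated b b' :=
    Associated.of_mul_left (Associated.of_eq (by rw [← eb, hb])) hua hum.ne_zero
  exact ⟨normalize c, a, b, hum, hum.of_mul_monic_left (ea ▸ hA), hum.of_mul_monic_left (eb ▸ hB),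
    (hrp.of_dvd_left h1.dvd).of_dvd_right h2.dvd, ea, eb⟩

theorem exists_param (A B C : F[X]) (hA : A.Monic) (hB : B.Monic) (hC : C.Monic) :
    ∃ a b c x y z s t r : F[X], a.Monic ∧ b.Monic ∧ c.Monic ∧ x.Monic ∧ y.Monic ∧ z.Monic ∧
      s.Monic ∧ t.Monic ∧ r.Monic ∧ Squarefree (a * b * c) ∧
      A = a * (x * y * (s * s)) ∧ B = b * (x * z * (t * t)) ∧ C = c * (y * z * (r * r)) := by
  obtain ⟨a1, s, ha1, hs, sa, rfl⟩ := exists_sq_mul A hA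
  obtain ⟨b1, t, hb1, ht, sb, rfl⟩ := exists_sq_mul B hB
  obtain ⟨c1, r, hc1, hr, sc, rfl⟩ := exists_sq_mul C hC
  obtain ⟨x, a2, b2, hx, ha2, hb2, rab, rfl, rfl⟩ := exists_gcd a1 b1 ha1 hb1
  obtain ⟨y, a3, c2, hy, ha3, hc2, rac, rfl, rfl⟩ := exists_gcd a2 c1 ha2 hc1
  obtain ⟨z, b3, c3, hz, hb3, hc3, rbc, rfl, rfl⟩ := exists_gcd b2 c2 hb2 hc2
  refine ⟨a3, b3, c3, x, y, z, s, t, r, ha3, hb3, hc3, hx, hy, hz, hs, ht, hr, ?_,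
    by ring, by ring, by ring⟩
  have h1 : IsRelPrime a3 b3 :=
    (rab.of_dvd_left (Dvd.intro_left _ rfl)).of_dvd_right (Dvd.intro_left _ rfl)
  have h2 : IsRelPrime a3 c3 := rac.of_dvd_right (Dvd.intro_left _ rfl)
  rw [squarefree_mul_iff, squarefree_mul_iff]
  refine ⟨h2.mul_left rbc, ⟨h1, ?_, ?_⟩, ?_⟩
  · exact sa.squarefree_of_dvd ⟨x * y, by ring⟩
  · exact sb.squarefree_of_dvd ⟨x * z, by ring⟩
  · exact sc.squarefree_of_dvd ⟨y * z, by ring⟩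


theorem card_irred_aux (d : ℕ) (hd : 1 ≤ d) :
    Fintype.card F ^ d ≤ d * ((monF F d).filter Irreducible).card
      + ∑ e ∈ d.properDivisors, Fintype.card F ^ e := by
  obtain ⟨p, hp⟩ := CharP.exists F
  have : Fact (Nat.Prime p) := ⟨CharP.char_is_prime F p⟩
  have : NeZero d := ⟨by omega⟩
  let K := FiniteField.Extension F p d
  have : Fintype K := Fintype.ofFinite K
  have hfr : Module.finrank F K = d := FiniteField.finrank_extension F p d
  have hcard : Fintype.card K = Fintype.card F ^ d := by
    rw [← Nat.card_eq_fintype_card, ← Nat.card_eq_fintype_card]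
    exact FiniteField.natCard_extension F p d
  have hint : ∀ α : K, IsIntegral F α := fun α => Algebra.IsIntegral.isIntegral α
  have hsub : (Finset.univ : Finset K) ⊆
      (Finset.univ.filter fun α : K => (minpoly F α).natDegree = d) ∪
      d.properDivisors.biUnion fun e => Finset.univ.filter fun α : K => (minpoly F α).natDegree = e := by
    intro α _
    have h1 := minpoly.degree_dvd (hint α)
    rw [hfr] at h1
    simp only [Finset.mem_union, Finset.mem_filter, Finset.mem_univ, true_and, Finset.mem_biUnion,
      Nat.mem_properDivisors]
    rcases (Nat.le_of_dvd hd h1).eq_or_lt with h | h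
    · exact Or.inl h
    · exact Or.inr ⟨_, ⟨h1, h⟩, rfl⟩
  have hA : (Finset.univ.filter fun α : K => (minpoly F α).natDegree = d).card ≤
      d * ((monF F d).filter Irreducible).card := by
    refine (Finset.card_le_mul_card_image (f := fun α : K => minpoly F α) _ d ?_).trans ?_
    · intro b hb
      obtain ⟨α, hα, rfl⟩ := Finset.mem_image.mp hb
      rw [Finset.mem_filter] at hα
      have hne := minpoly.ne_zero (hint α)
      calc _ ≤ ((minpoly F α).aroots K).toFinset.card := by
            apply Finset.card_le_card
            intro β hβ
            simp only [Finset.mem_filter] at hβ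
            rw [Multiset.mem_toFinset, mem_aroots]
            refine ⟨hne, ?_⟩
            rw [← hβ.2]
            exact minpoly.aeval F β
        _ ≤ ((minpoly F α).aroots K).card := Multiset.toFinset_card_le _
        _ ≤ ((minpoly F α).map (algebraMap F K)).natDegree := card_roots' _
        _ = d := by rw [natDegree_map, hα.2]
    · gcongr
      intro b hb
      obtain ⟨α, hα, rfl⟩ := Finset.mem_image.mp hb
      rw [Finset.mem_filter] at hα
      rw [Finset.mem_filter, mem_monF]
      exact ⟨⟨minpoly.monic (hint α), hα.2⟩, minpoly.irreducible (hint α)⟩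
  have hB : ∀ e ∈ d.properDivisors,
      (Finset.univ.filter fun α : K => (minpoly F α).natDegree = e).card ≤ Fintype.card F ^ e := by
    intro e he
    have he0 : e ≠ 0 := (Nat.pos_of_mem_properDivisors he).ne'
    have hq : 1 < Fintype.card F := Fintype.one_lt_card
    have hne : (X ^ Fintype.card F ^ e - X : K[X]) ≠ 0 :=
      FiniteField.X_pow_card_pow_sub_X_ne_zero _ he0 hq
    calc _ ≤ (X ^ Fintype.card F ^ e - X : K[X]).roots.toFinset.card := by
            apply Finset.card_le_card
            intro β hβ
            simp only [Finset.mem_filter] at hβ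
            rw [Multiset.mem_toFinset, mem_roots hne]
            have h := ((minpoly.irreducible (hint β)).natDegree_dvd_iff_dvd_X_pow_card_pow_sub_X
              (n := e)).mp (by rw [hβ.2])
            have h3 := minpoly.dvd_iff.mp h
            simpa [IsRoot.def] using h3
        _ ≤ (X ^ Fintype.card F ^ e - X : K[X]).roots.card := Multiset.toFinset_card_le _
        _ ≤ (X ^ Fintype.card F ^ e - X : K[X]).natDegree := card_roots' _
        _ = Fintype.card F ^ e := FiniteField.X_pow_card_pow_sub_X_natDegree_eq _ he0 hq
  have := Finset.card_le_card hsub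
  rw [Finset.card_univ, hcard] at this
  refine this.trans ((Finset.card_union_le _ _).trans ?_)
  exact add_le_add hA (Finset.card_biUnion_le.trans (Finset.sum_le_sum hB))

theorem geom_aux (q : ℕ) (hq : 2 ≤ q) (h : ℕ) :
    ∑ e ∈ Finset.Icc 1 (h + 1), q ^ e + q ≤ 2 * q ^ (h + 1) := by
  induction h with
  | zero => simp; omega
  | succ k ih =>
    rw [Finset.sum_Icc_succ_top (by omega)]
    have : 2 * q ^ (k + 1) ≤ q ^ (k + 1 + 1) := by
      rw [pow_succ q (k + 1)]; nlinarith [Nat.zero_le (q ^ (k + 1))]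
    omega

theorem divisors_aux (q : ℕ) (hq : 2 ≤ q) (d : ℕ) (hd : 1 ≤ d) :
    2 * ∑ e ∈ d.properDivisors, q ^ e ≤ q ^ d := by
  have h1 : ∑ e ∈ d.properDivisors, q ^ e ≤ ∑ e ∈ Finset.Icc 1 (d / 2), q ^ e := by
    apply Finset.sum_le_sum_of_subset
    intro e he
    have h0 := Nat.pos_of_mem_properDivisors he
    rw [Nat.mem_properDivisors] at he
    obtain ⟨⟨k, hk⟩, hlt⟩ := he
    rw [Finset.mem_Icc]
    refine ⟨h0, ?_⟩
    have : 2 ≤ k := by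
      by_contra hk2
      have : k ≤ 1 := by omega
      nlinarith
    rw [Nat.le_div_iff_mul_le (by norm_num)]
    nlinarith
  rcases Nat.lt_or_ge d 3 with h3 | h3
  · interval_cases d
    · simp at h1 ⊢
    · simp at h1
      nlinarith
  · obtain ⟨h, hh⟩ : ∃ h, d / 2 = h + 1 := ⟨d / 2 - 1, by omega⟩
    rw [hh] at h1
    have h2 := geom_aux q hq h
    have h4 : q ^ (h + 1 + 2) ≤ q ^ d := Nat.pow_le_pow_right (by omega) (by omega)
    rw [pow_add] at h4
    have : 4 * q ^ (h + 1) ≤ q ^ (h + 1) * q ^ 2 := by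
      rw [mul_comm]; gcongr; nlinarith
    omega

theorem card_irred (d : ℕ) (hd : 1 ≤ d) :
    Fintype.card F ^ d ≤ 2 * d * ((monF F d).filter Irreducible).card := by
  have h1 := card_irred_aux (F := F) d hd
  have h2 := divisors_aux (Fintype.card F) two_le_card d hd
  nlinarith

theorem sum_le_of_surj {α β : Type*} (S : Finset α) (T : Finset β) (g : α → β) (f : β → ℝ)
    (hf : ∀ b, 0 ≤ f b) (h : ∀ b ∈ T, ∃ a ∈ S, g a = b) :
    ∑ b ∈ T, f b ≤ ∑ a ∈ S, f (g a) := by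
  have h1 : T ⊆ S.image g := fun b hb => Finset.mem_image.mpr (h b hb)
  refine (Finset.sum_le_sum_of_subset_of_nonneg h1 fun b _ _ => hf b).trans ?_
  rw [← Finset.sum_fiberwise_of_maps_to (s := S) (t := S.image g) (g := g)
    (fun a ha => Finset.mem_image_of_mem g ha)]
  apply Finset.sum_le_sum
  intro b hb
  obtain ⟨a, ha, rfl⟩ := Finset.mem_image.mp hb
  exact Finset.single_le_sum (f := fun a => f (g a)) (fun _ _ => hf _)
    (Finset.mem_filter.mpr ⟨ha, rfl⟩)

variable (F) in
noncomputable def trip (N : ℕ) : Finset (F[X] × F[X] × F[X]) :=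
  (monL F N ×ˢ monL F N ×ˢ monL F N).filter fun v => Squarefree (v.1 * v.2.1 * v.2.2)

theorem sum_trip (N : ℕ) :
    ((N : ℝ) + 1) ^ 3 ≤ 64 * ∑ v ∈ trip F N, wt (v.1 * v.2.1 * v.2.2) := by
  let L := monL F N
  have key := sum_le_of_surj (trip F N ×ˢ ((L ×ˢ L ×ˢ L) ×ˢ (L ×ˢ L ×ˢ L)))
    (L ×ˢ L ×ˢ L)
    (fun u => (u.1.1 * (u.2.1.1 * u.2.1.2.1 * (u.2.2.1 * u.2.2.1)),
      u.1.2.1 * (u.2.1.1 * u.2.1.2.2 * (u.2.2.2.1 * u.2.2.2.1)),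
      u.1.2.2 * (u.2.1.2.1 * u.2.1.2.2 * (u.2.2.2.2 * u.2.2.2.2))))
    (fun v => wt v.1 * (wt v.2.1 * wt v.2.2))
    (fun v => (mul_pos (wt_pos _) (mul_pos (wt_pos _) (wt_pos _))).le)
    (by
      rintro ⟨A, B, C⟩ h
      simp only [Finset.mem_product, L, mem_monL] at h
      obtain ⟨⟨hA, dA⟩, ⟨hB, dB⟩, hC, dC⟩ := h
      obtain ⟨a, b, c, x, y, z, s, t, r, ha, hb, hc, hx, hy, hz, hs, ht, hr, hsq, rfl, rfl, rfl⟩ :=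
        exists_param A B C hA hB hC
      refine ⟨((a, b, c), (x, y, z), (s, t, r)), ?_, rfl⟩
      rw [ha.natDegree_mul ((hx.mul hy).mul (hs.mul hs)), (hx.mul hy).natDegree_mul (hs.mul hs),
        hx.natDegree_mul hy, hs.natDegree_mul hs] at dA
      rw [hb.natDegree_mul ((hx.mul hz).mul (ht.mul ht)), (hx.mul hz).natDegree_mul (ht.mul ht),
        hx.natDegree_mul hz, ht.natDegree_mul ht] at dB
      rw [hc.natDegree_mul ((hy.mul hz).mul (hr.mul hr)), (hy.mul hz).natDegree_mul (hr.mul hr),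
        hy.natDegree_mul hz, hr.natDegree_mul hr] at dC
      simp only [Finset.mem_product, L, mem_monL, trip, Finset.mem_filter]
      refine ⟨⟨⟨⟨ha, ?_⟩, ⟨hb, ?_⟩, hc, ?_⟩, hsq⟩, ⟨⟨hx, ?_⟩, ⟨hy, ?_⟩, hz, ?_⟩, ⟨hs, ?_⟩, ⟨ht, ?_⟩, hr, ?_⟩ <;>
        omega)
  have e1 : ∑ v ∈ L ×ˢ L ×ˢ L, wt v.1 * (wt v.2.1 * wt v.2.2) = ((N : ℝ) + 1) ^ 3 := by
    rw [Finset.sum_product, ← Finset.sum_mul_sum L (L ×ˢ L) (fun a => wt a) fun v => wt v.1 * wt v.2,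
      Finset.sum_product, ← Finset.sum_mul_sum L L, sum_wt]
    ring
  have e3 : ∑ v ∈ L ×ˢ L ×ˢ L, wt v.1 ^ 2 * (wt v.2.1 ^ 2 * wt v.2.2 ^ 2)
      = (∑ M ∈ L, wt M ^ 2) ^ 3 := by
    rw [Finset.sum_product,
      ← Finset.sum_mul_sum L (L ×ˢ L) (fun a => wt a ^ 2) fun v => wt v.1 ^ 2 * wt v.2 ^ 2,
      Finset.sum_product,
      ← Finset.sum_mul_sum L L (fun a => wt a ^ 2) (fun a => wt a ^ 2)]
    ring
  rw [e1] at key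
  refine key.trans ?_
  have e2 : ∀ u ∈ trip F N ×ˢ ((L ×ˢ L ×ˢ L) ×ˢ (L ×ˢ L ×ˢ L)),
      wt (u.1.1 * (u.2.1.1 * u.2.1.2.1 * (u.2.2.1 * u.2.2.1))) *
      (wt (u.1.2.1 * (u.2.1.1 * u.2.1.2.2 * (u.2.2.2.1 * u.2.2.2.1))) *
      wt (u.1.2.2 * (u.2.1.2.1 * u.2.1.2.2 * (u.2.2.2.2 * u.2.2.2.2)))) =
      wt (u.1.1 * u.1.2.1 * u.1.2.2) * ((wt u.2.1.1 ^ 2 * (wt u.2.1.2.1 ^ 2 * wt u.2.1.2.2 ^ 2)) *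
        (wt u.2.2.1 ^ 2 * (wt u.2.2.2.1 ^ 2 * wt u.2.2.2.2 ^ 2))) := by
    rintro ⟨⟨a, b, c⟩, ⟨x, y, z⟩, s, t, r⟩ h
    simp only [Finset.mem_product, L, mem_monL, trip, Finset.mem_filter] at h
    obtain ⟨⟨⟨⟨ha, -⟩, ⟨hb, -⟩, hc, -⟩, -⟩, ⟨⟨hx, -⟩, ⟨hy, -⟩, hz, -⟩, ⟨hs, -⟩, ⟨ht, -⟩, hr, -⟩ := h
    simp only
    rw [wt_mul ha ((hx.mul hy).mul (hs.mul hs)), wt_mul (hx.mul hy) (hs.mul hs), wt_mul hx hy,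
      wt_mul hs hs, wt_mul hb ((hx.mul hz).mul (ht.mul ht)), wt_mul (hx.mul hz) (ht.mul ht),
      wt_mul hx hz, wt_mul ht ht, wt_mul hc ((hy.mul hz).mul (hr.mul hr)),
      wt_mul (hy.mul hz) (hr.mul hr), wt_mul hy hz, wt_mul hr hr, wt_mul (ha.mul hb) hc,
      wt_mul ha hb]
    ring
  rw [Finset.sum_congr rfl e2, Finset.sum_product,
    ← Finset.sum_mul_sum (trip F N) ((L ×ˢ L ×ˢ L) ×ˢ (L ×ˢ L ×ˢ L))
      (fun v => wt (v.1 * v.2.1 * v.2.2))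
      (fun u => (wt u.1.1 ^ 2 * (wt u.1.2.1 ^ 2 * wt u.1.2.2 ^ 2)) *
        (wt u.2.1 ^ 2 * (wt u.2.2.1 ^ 2 * wt u.2.2.2 ^ 2))),
    Finset.sum_product,
    ← Finset.sum_mul_sum (L ×ˢ L ×ˢ L) (L ×ˢ L ×ˢ L)
      (fun v => wt v.1 ^ 2 * (wt v.2.1 ^ 2 * wt v.2.2 ^ 2))
      (fun v => wt v.1 ^ 2 * (wt v.2.1 ^ 2 * wt v.2.2 ^ 2)), e3, mul_comm]
  have h0 : 0 ≤ ∑ M ∈ L, wt M ^ 2 := Finset.sum_nonneg fun _ _ => sq_nonneg _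
  have hS := sum_wt_sq (F := F) N
  have h64 : (∑ M ∈ L, wt M ^ 2) ^ 3 * (∑ M ∈ L, wt M ^ 2) ^ 3 ≤ 64 := by
    calc _ ≤ (2 : ℝ) ^ 3 * 2 ^ 3 := by gcongr
      _ = 64 := by norm_num
  gcongr
  exact Finset.sum_nonneg fun _ _ => (wt_pos _).le

theorem eq_of_primes {a a' : F[X]} (ha : a.Monic) (ha' : a'.Monic) (sa : Squarefree a)
    (sa' : Squarefree a') (h : ∀ P : F[X], Irreducible P → normalize P = P → (P ∣ a ↔ P ∣ a')) :
    a = a' := by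
  have e := UniqueFactorizationMonoid.prod_normalizedFactors_eq ha.ne_zero
  have e' := UniqueFactorizationMonoid.prod_normalizedFactors_eq ha'.ne_zero
  rw [ha.normalize_eq_self] at e
  rw [ha'.normalize_eq_self] at e'
  rw [← e, ← e']
  congr 1
  rw [Multiset.Nodup.ext
    ((UniqueFactorizationMonoid.squarefree_iff_nodup_normalizedFactors ha.ne_zero).mp sa)
    ((UniqueFactorizationMonoid.squarefree_iff_nodup_normalizedFactors ha'.ne_zero).mp sa')]
  intro P
  rw [UniqueFactorizationMonoid.mem_normalizedFactors_iff' ha.ne_zero,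
    UniqueFactorizationMonoid.mem_normalizedFactors_iff' ha'.ne_zero]
  constructor
  · rintro ⟨h1, h2, h3⟩
    exact ⟨h1, h2, (h P h1 h2).mp h3⟩
  · rintro ⟨h1, h2, h3⟩
    exact ⟨h1, h2, (h P h1 h2).mpr h3⟩

noncomputable def cls (v : F[X] × F[X] × F[X]) (P : F[X]) : Fin 3 :=
  if P ∣ v.1 then 0 else if P ∣ v.2.1 then 1 else 2

theorem cls_spec {a b c P : F[X]} (hs : Squarefree (a * b * c)) (hP : Irreducible P)
    (hd : P ∣ a * b * c) :
    (P ∣ a ↔ cls (a, b, c) P = 0) ∧ (P ∣ b ↔ cls (a, b, c) P = 1) ∧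
      (P ∣ c ↔ cls (a, b, c) P = 2) := by
  have hpr := hP.prime
  rw [squarefree_mul_iff, squarefree_mul_iff] at hs
  obtain ⟨h1, ⟨h2, -, -⟩, -⟩ := hs
  have hab : ¬ (P ∣ a ∧ P ∣ b) := fun h => hP.not_isUnit (h2 h.1 h.2)
  have hac : ¬ (P ∣ a ∧ P ∣ c) := fun h => hP.not_isUnit (h1 (h.1.mul_right b) h.2)
  have hbc : ¬ (P ∣ b ∧ P ∣ c) := fun h => hP.not_isUnit (h1 (h.1.mul_left a) h.2)
  have hor : (P ∣ a ∨ P ∣ b) ∨ P ∣ c := by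
    rcases hpr.dvd_or_dvd hd with h | h
    · exact Or.inl (hpr.dvd_or_dvd h)
    · exact Or.inr h
  unfold cls
  simp only
  by_cases ha : P ∣ a
  · have hb : ¬ P ∣ b := fun h => hab ⟨ha, h⟩
    have hc : ¬ P ∣ c := fun h => hac ⟨ha, h⟩
    simp [ha, hb, hc]
  · by_cases hb : P ∣ b
    · have hc : ¬ P ∣ c := fun h => hbc ⟨hb, h⟩
      simp [ha, hb, hc]
    · have hc : P ∣ c := by tauto
      simp [ha, hb, hc]

theorem card_fiber (M : F[X]) (hs : Squarefree M) (hM : M.Monic)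
    (S : Finset (F[X] × F[X] × F[X]))
    (hS : ∀ v ∈ S, v.1.Monic ∧ v.2.1.Monic ∧ v.2.2.Monic ∧ v.1 * v.2.1 * v.2.2 = M) :
    S.card ≤ 3 ^ omegaPoly M := by
  let s := (UniqueFactorizationMonoid.normalizedFactors M).toFinset
  have hcard : (Finset.univ : Finset (s → Fin 3)).card = 3 ^ omegaPoly M := by
    rw [Finset.card_univ, Fintype.card_fun, Fintype.card_fin, Fintype.card_coe, omegaPoly]
  rw [← hcard]
  apply Finset.card_le_card_of_injOn (fun v (P : s) => cls v P.1) (fun _ _ => Finset.mem_univ _)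
  rintro ⟨a, b, c⟩ h ⟨a', b', c'⟩ h' heq
  obtain ⟨ha, hb, hc, e⟩ := hS _ h
  obtain ⟨ha', hb', hc', e'⟩ := hS _ h'
  simp only at ha hb hc e ha' hb' hc' e'
  have hq : ∀ P : F[X], Irreducible P → normalize P = P → P ∣ M →
      cls (a, b, c) P = cls (a', b', c') P := by
    intro P h1 h2 h3
    exact congrFun heq ⟨P, by
      rw [Multiset.mem_toFinset, UniqueFactorizationMonoid.mem_normalizedFactors_iff' hM.ne_zero]
      exact ⟨h1, h2, h3⟩⟩
  have da : a ∣ M := ⟨b * c, by rw [← e]; ring⟩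
  have db : b ∣ M := ⟨a * c, by rw [← e]; ring⟩
  have dc : c ∣ M := ⟨a * b, by rw [← e]; ring⟩
  have da' : a' ∣ M := ⟨b' * c', by rw [← e']; ring⟩
  have db' : b' ∣ M := ⟨a' * c', by rw [← e']; ring⟩
  have dc' : c' ∣ M := ⟨a' * b', by rw [← e']; ring⟩
  have hall : ∀ P : F[X], Irreducible P → normalize P = P → P ∣ M →
      (P ∣ a ↔ P ∣ a') ∧ (P ∣ b ↔ P ∣ b') ∧ (P ∣ c ↔ P ∣ c') := by
    intro P h1 h2 h3
    obtain ⟨x1, x2, x3⟩ := cls_spec (e.symm ▸ hs) h1 (e.symm ▸ h3)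
    obtain ⟨y1, y2, y3⟩ := cls_spec (e'.symm ▸ hs) h1 (e'.symm ▸ h3)
    rw [x1, x2, x3, y1, y2, y3, hq P h1 h2 h3]
    simp
  have r1 : a = a' := eq_of_primes ha ha' (hs.squarefree_of_dvd da) (hs.squarefree_of_dvd da')
    fun P h1 h2 => ⟨fun h => (hall P h1 h2 (h.trans da)).1.mp h,
      fun h => (hall P h1 h2 (h.trans da')).1.mpr h⟩
  have r2 : b = b' := eq_of_primes hb hb' (hs.squarefree_of_dvd db) (hs.squarefree_of_dvd db')
    fun P h1 h2 => ⟨fun h => (hall P h1 h2 (h.trans db)).2.1.mp h,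
      fun h => (hall P h1 h2 (h.trans db')).2.1.mpr h⟩
  have r3 : c = c' := eq_of_primes hc hc' (hs.squarefree_of_dvd dc) (hs.squarefree_of_dvd dc')
    fun P h1 h2 => ⟨fun h => (hall P h1 h2 (h.trans dc)).2.2.mp h,
      fun h => (hall P h1 h2 (h.trans dc')).2.2.mpr h⟩
  rw [r1, r2, r3]

variable (F) in
noncomputable def tripD (n : ℕ) : Finset (F[X] × F[X] × F[X]) :=
  (trip F n).filter fun v => (v.1 * v.2.1 * v.2.2).natDegree = n

theorem mem_trip {N : ℕ} {v : F[X] × F[X] × F[X]} : v ∈ trip F N ↔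
    ((v.1.Monic ∧ v.1.natDegree ≤ N) ∧ (v.2.1.Monic ∧ v.2.1.natDegree ≤ N) ∧
      (v.2.2.Monic ∧ v.2.2.natDegree ≤ N)) ∧ Squarefree (v.1 * v.2.1 * v.2.2) := by
  simp only [trip, Finset.mem_filter, Finset.mem_product, mem_monL]

theorem card_tripD (n : ℕ) :
    (tripD F n).card ≤ ∑ M ∈ monF F n, if Squarefree M then 3 ^ omegaPoly M else 0 := by
  rw [Finset.card_eq_sum_card_fiberwise (f := fun v => v.1 * v.2.1 * v.2.2) (t := monF F n)]
  · apply Finset.sum_le_sum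
    intro M hM
    rw [mem_monF] at hM
    split_ifs with hs
    · apply card_fiber M hs hM.1
      intro v hv
      rw [Finset.mem_filter, tripD, Finset.mem_filter, mem_trip] at hv
      exact ⟨hv.1.1.1.1.1, hv.1.1.1.2.1.1, hv.1.1.1.2.2.1, hv.2⟩
    · rw [Nat.le_zero, Finset.card_eq_zero, Finset.filter_eq_empty_iff]
      rintro v hv rfl
      rw [tripD, Finset.mem_filter, mem_trip] at hv
      exact hs hv.1.2
  · intro v hv
    rw [Finset.mem_coe, tripD, Finset.mem_filter, mem_trip] at hv
    rw [Finset.mem_coe, mem_monF]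
    exact ⟨(hv.1.1.1.1.mul hv.1.1.2.1.1).mul hv.1.1.2.2.1, hv.2⟩

theorem natDegree_trip {N : ℕ} {v : F[X] × F[X] × F[X]} (hv : v ∈ trip F N) :
    (v.1 * v.2.1 * v.2.2).natDegree = v.1.natDegree + v.2.1.natDegree + v.2.2.natDegree := by
  rw [mem_trip] at hv
  rw [(hv.1.1.1.mul hv.1.2.1.1).natDegree_mul hv.1.2.2.1, hv.1.1.1.natDegree_mul hv.1.2.1.1]

theorem sum_irred_le (n N : ℕ) (hN : 6 * N < n) :
    ∑ v ∈ trip F N,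
      ((monF F (n - (v.1 * v.2.1 * v.2.2).natDegree)).filter Irreducible).card
      ≤ (tripD F n).card := by
  rw [← Finset.card_sigma]
  apply Finset.card_le_card_of_injOn
    (fun u : (Σ _ : F[X] × F[X] × F[X], F[X]) => (u.1.1 * u.2, u.1.2.1, u.1.2.2))
  · rintro ⟨⟨a, b, c⟩, P⟩ h
    rw [Finset.mem_coe, Finset.mem_sigma] at h
    obtain ⟨hv, hP⟩ := h
    have hd := natDegree_trip hv
    rw [mem_trip] at hv
    rw [Finset.mem_filter, mem_monF] at hP
    simp only at hv hP hd
    obtain ⟨⟨⟨ha, da⟩, ⟨hb, db⟩, hc, dc⟩, hs⟩ := hv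
    obtain ⟨⟨hPm, hPd⟩, hPi⟩ := hP
    rw [hd] at hPd
    have e : a * P * b * c = P * (a * b * c) := by ring
    have habc := (ha.mul hb).mul hc
    rw [Finset.mem_coe, tripD, Finset.mem_filter, mem_trip]
    simp only
    rw [e, hPm.natDegree_mul habc, ha.natDegree_mul hPm, hd, squarefree_mul_iff]
    refine ⟨⟨⟨⟨ha.mul hPm, by omega⟩, ⟨hb, by omega⟩, hc, by omega⟩, ?_, hPi.squarefree, hs⟩,
      by omega⟩
    rw [hPi.isRelPrime_iff_not_dvd]
    intro hdv
    have := natDegree_le_of_dvd hdv habc.ne_zero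
    omega
  · rintro ⟨⟨a, b, c⟩, P⟩ h ⟨⟨a', b', c'⟩, P'⟩ h' heq
    rw [Finset.mem_coe, Finset.mem_sigma] at h h'
    obtain ⟨hv, hP⟩ := h
    obtain ⟨hv', hP'⟩ := h'
    have hd := natDegree_trip hv
    have hd' := natDegree_trip hv'
    rw [mem_trip] at hv hv'
    rw [Finset.mem_filter, mem_monF] at hP hP'
    simp only [Prod.mk.injEq] at hv hP hd hv' hP' hd' heq
    obtain ⟨e1, rfl, rfl⟩ := heq
    have hPP : P = P' := by
      have : P ∣ a' * P' := e1 ▸ Dvd.intro_left a rfl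
      rcases hP.2.prime.dvd_or_dvd this with h | h
      · have := natDegree_le_of_dvd h hv'.1.1.1.ne_zero
        omega
      · exact eq_of_monic_of_associated hP.1.1 hP'.1.1 (hP.2.associated_of_dvd hP'.2 h)
    subst hPP
    have := mul_right_cancel₀ hP.1.1.ne_zero e1
    rw [this]

theorem main_bound (n : ℕ) (hn : 1 ≤ n) :
    (1 / 27648 : ℝ) * (n : ℝ) ^ 2 ≤
      (∑ M ∈ monF F n, if Squarefree M then (3 : ℝ) ^ omegaPoly M else 0) /
        (Fintype.card F : ℝ) ^ n := by
  obtain ⟨N, hN1, hN2⟩ : ∃ N, 6 * N < n ∧ n ≤ 6 * (N + 1) := ⟨(n - 1) / 6, by omega, by omega⟩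
  have hq : (0 : ℝ) < Fintype.card F := by exact_mod_cast Fintype.card_pos
  have hn0 : (0 : ℝ) < n := by exact_mod_cast hn
  have h1 := (sum_irred_le (F := F) n N hN1).trans (card_tripD n)
  have h1' : (∑ v ∈ trip F N,
      (((monF F (n - (v.1 * v.2.1 * v.2.2).natDegree)).filter Irreducible).card : ℝ)) ≤
      ∑ M ∈ monF F n, if Squarefree M then (3 : ℝ) ^ omegaPoly M else 0 := by
    exact_mod_cast h1
  have h2 : ∀ v ∈ trip F N, (Fintype.card F : ℝ) ^ n / (2 * n) * wt (v.1 * v.2.1 * v.2.2) ≤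
      (((monF F (n - (v.1 * v.2.1 * v.2.2).natDegree)).filter Irreducible).card : ℝ) := by
    intro v hv
    have hd := natDegree_trip hv
    rw [mem_trip] at hv
    set m := (v.1 * v.2.1 * v.2.2).natDegree with hm
    have hmn : m < n := by omega
    have h3 := card_irred (F := F) (n - m) (by omega)
    have h3' : (Fintype.card F : ℝ) ^ (n - m) ≤
        2 * n * ((monF F (n - m)).filter Irreducible).card := by
      have : Fintype.card F ^ (n - m) ≤ 2 * n * ((monF F (n - m)).filter Irreducible).card := by
        refine h3.trans ?_
        gcongr
        omega
      exact_mod_cast this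
    rw [wt, ← hm, div_mul_eq_mul_div, ← div_eq_mul_inv, div_le_iff₀ (by positivity),
      div_le_iff₀ (by positivity)]
    calc (Fintype.card F : ℝ) ^ n = (Fintype.card F : ℝ) ^ (n - m) * (Fintype.card F : ℝ) ^ m := by
          rw [← pow_add]; congr 1; omega
      _ ≤ (2 * n * ((monF F (n - m)).filter Irreducible).card) * (Fintype.card F : ℝ) ^ m := by gcongr
      _ = _ := by ring
  have h4 := sum_trip (F := F) N
  have h5 := (Finset.sum_le_sum h2).trans h1'
  rw [← Finset.mul_sum] at h5
  rw [le_div_iff₀ (by positivity)]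
  refine le_trans ?_ h5
  have h6 : (n : ℝ) ^ 3 ≤ 216 * (64 * ∑ v ∈ trip F N, wt (v.1 * v.2.1 * v.2.2)) := by
    have h7 : (n : ℝ) ≤ 6 * ((N : ℝ) + 1) := by exact_mod_cast hN2
    calc (n : ℝ) ^ 3 ≤ (6 * ((N : ℝ) + 1)) ^ 3 := by gcongr
      _ = 216 * ((N : ℝ) + 1) ^ 3 := by ring
      _ ≤ _ := by gcongr
  calc (1 / 27648 : ℝ) * (n : ℝ) ^ 2 * (Fintype.card F : ℝ) ^ n
      = (Fintype.card F : ℝ) ^ n / (2 * n) * ((n : ℝ) ^ 3 / 13824) := by field_simp; norm_num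
    _ ≤ _ := by gcongr; linarith

end

/-- With `H(n) = ∑_{M monic, deg M = n} μ²(M) 3^{ω(M)} / |M|`, there is a constant
`c₁ > 0` (depending only on `q`) such that `H(n) ≥ c₁ n²` for all `n ≥ 1`. -/
theorem H_lower_bound (Fq : Type*) [Field Fq] [Fintype Fq] :
    ∃ c₁ : ℝ, 0 < c₁ ∧ ∀ n : ℕ, 1 ≤ n →
      c₁ * (n : ℝ) ^ 2 ≤
        ∑ᶠ M ∈ {M : Polynomial Fq | M.Monic ∧ M.natDegree = n},
          (if Squarefree M then (3 : ℝ) ^ omegaPoly M else 0) /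
            (Fintype.card Fq : ℝ) ^ M.natDegree := by
  refine ⟨1 / 27648, by norm_num, fun n hn => ?_⟩
  refine (main_bound (F := Fq) n hn).trans_eq ?_
  rw [finsum_mem_eq_finite_toFinset_sum _ (monSet_finite n), Finset.sum_div]
  apply Finset.sum_congr rfl
  intro M hM
  rw [mem_monF] at hM
  rw [hM.2]
end

section
/- Fix a nonzero constant a ∈ F_q^* and an integer k ≥ 2. Then for every 0 < B < 1, (1/q^n)·#{f ∈ M_{n,q} : f and f + a are both k-free} = ∏_{P monic irreducible} (1 − 2/q^{k·deg P}) + O(n^{−B}) as n → ∞. -/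
open scoped Classical
open Polynomial Filter Asymptotics

/-- `f` is `k`-free: no `k`-th power of an irreducible polynomial divides `f`. -/
def IsKFree {Fq : Type*} [Field Fq] (k : ℕ) (f : Polynomial Fq) : Prop :=
  ∀ P : Polynomial Fq, Irreducible P → ¬ P ^ k ∣ f

namespace KFree

/-- Preimages under a surjective homomorphism of finite groups are equidistributed. -/
lemma fiber_count {V W : Type*} [AddCommGroup V] [AddCommGroup W] [Finite V] [Finite W]
    (φ : V →+ W) (hφ : Function.Surjective φ) (T : Set W) :
    Nat.card {v : V // φ v ∈ T} * Nat.card W = Nat.card V * Nat.card T := by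
  have := Fintype.ofFinite V
  have := Fintype.ofFinite W
  set c := (Finset.univ.filter (fun v => φ v = 0)).card with hc
  have key : ∀ w, (Finset.univ.filter (fun v => φ v = w)).card = c := fun w =>
    AddMonoidHom.card_fiber_eq_of_mem_range φ (hφ w) (hφ 0)
  have gen : ∀ T : Finset W, (Finset.univ.filter (fun v => φ v ∈ T)).card = T.card * c := by
    intro T
    rw [Finset.card_eq_sum_card_fiberwise (f := φ) (t := T)]
    · rw [Finset.sum_const_nat (m := c)]
      intro w hw
      rw [← key w]
      congr 1
      ext v
      simp only [Finset.mem_filter, Finset.mem_univ, true_and]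
      constructor
      · exact fun h => h.2
      · rintro rfl; exact ⟨hw, rfl⟩
    · intro v hv
      simpa using hv
  have h1 := gen T.toFinset
  have h2 := gen Finset.univ
  simp only [Finset.mem_univ, Finset.filter_true, Finset.card_univ, Set.mem_toFinset] at h1 h2
  rw [Nat.card_eq_fintype_card, Nat.card_eq_fintype_card, Nat.card_eq_fintype_card,
    Nat.card_eq_fintype_card, Fintype.card_subtype, h1, h2, ← Set.toFinset_card]
  ring

variable {F : Type*} [Field F] [Fintype F]

instance finite_degreeLT (n : ℕ) : Finite (degreeLT F n) :=
  Finite.of_equiv _ (degreeLTEquiv F n).toEquiv.symm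

lemma card_degreeLT (n : ℕ) : Nat.card (degreeLT F n) = Fintype.card F ^ n := by
  rw [Nat.card_congr (degreeLTEquiv F n).toEquiv]
  simp

lemma finite_quot {Q : F[X]} (hQ : Q.Monic) : Finite (F[X] ⧸ Ideal.span {Q}) := by
  have : Module.Finite F (AdjoinRoot Q) := hQ.finite_adjoinRoot
  have : Module.Finite F (F[X] ⧸ Ideal.span {Q}) := this
  exact Module.finite_of_finite F

lemma card_quot {Q : F[X]} (hQ : Q.Monic) :
    Nat.card (F[X] ⧸ Ideal.span {Q}) = Fintype.card F ^ Q.natDegree := by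
  have : Module.Finite F (AdjoinRoot Q) := hQ.finite_adjoinRoot
  have : Module.Finite F (F[X] ⧸ Ideal.span {Q}) := this
  rw [Module.natCard_eq_pow_finrank (K := F), finrank_quotient_span_eq_natDegree,
    Nat.card_eq_fintype_card]

lemma count {ι : Type*} [Fintype ι] (Q : ι → F[X]) (hQ : ∀ i, (Q i).Monic)
    (hco : Pairwise fun i j => IsCoprime (Q i) (Q j)) (n : ℕ)
    (hn : ∑ i, (Q i).natDegree ≤ n) (T : ∀ i, Set (F[X] ⧸ Ideal.span {Q i})) :
    Nat.card {f : F[X] // f.Monic ∧ f.natDegree = n ∧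
      ∀ i, Ideal.Quotient.mk (Ideal.span {Q i}) f ∈ T i} *
      ∏ i, Fintype.card F ^ (Q i).natDegree =
    Fintype.card F ^ n * ∏ i, Nat.card (T i) := by
  have hfin := fun i => finite_quot (hQ i)
  let φ : degreeLT F n →+ (∀ i, F[X] ⧸ Ideal.span {Q i}) :=
    (RingHom.pi fun i => Ideal.Quotient.mk (Ideal.span {Q i})).toAddMonoidHom.comp
      (degreeLT F n).subtype.toAddMonoidHom
  have hφa : ∀ g i, φ g i = Ideal.Quotient.mk (Ideal.span {Q i}) g.1 := fun g i => rfl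
  have hφ : Function.Surjective φ := by
    intro x
    obtain ⟨r, hr⟩ := Ideal.pi_quotient_surjective (I := fun i => Ideal.span {Q i})
      (by
        intro i j hij
        exact (Ideal.isCoprime_span_singleton_iff _ _).2 (hco hij)) x
    have hM : (∏ i, Q i).Monic := monic_prod_of_monic _ _ fun i _ => hQ i
    refine ⟨⟨r %ₘ ∏ i, Q i, ?_⟩, ?_⟩
    · rw [mem_degreeLT]
      refine (degree_modByMonic_lt _ hM).trans_le ?_
      rw [degree_eq_natDegree hM.ne_zero, natDegree_prod_of_monic _ _ fun i _ => hQ i]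
      exact_mod_cast hn
    · funext i
      rw [hφa, ← hr i]
      rw [Ideal.Quotient.mk_eq_mk_iff_sub_mem, Ideal.mem_span_singleton]
      have h1 := modByMonic_add_div r (∏ i, Q i)
      have h2 : r %ₘ (∏ i, Q i) - r = -((∏ i, Q i) * (r /ₘ ∏ i, Q i)) := by
        linear_combination h1
      simp only [h2]
      exact (dvd_neg.2 ((Finset.dvd_prod_of_mem Q (Finset.mem_univ i)).mul_right _))
  have h := fiber_count φ hφ
    {x | ∀ i, x i + Ideal.Quotient.mk (Ideal.span {Q i}) (X ^ n) ∈ T i}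
  rw [Nat.card_pi, card_degreeLT] at h
  simp only [card_quot (hQ _)] at h
  have e1 : Nat.card {f : F[X] // f.Monic ∧ f.natDegree = n ∧
      ∀ i, Ideal.Quotient.mk (Ideal.span {Q i}) f ∈ T i} = Nat.card {v : degreeLT F n //
      φ v ∈ {x | ∀ i, x i + Ideal.Quotient.mk (Ideal.span {Q i}) (X ^ n) ∈ T i}} := by
    apply Nat.card_congr
    refine Equiv.trans ?_ (Equiv.subtypeEquiv (p := fun f =>
      ∀ i, Ideal.Quotient.mk (Ideal.span {Q i}) f.1 ∈ T i) (monicEquivDegreeLT (R := F) n) ?_)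
    · refine Equiv.trans (Equiv.subtypeEquivRight fun f => ?_)
        (Equiv.subtypeSubtypeEquivSubtypeInter (fun f : F[X] => f.Monic ∧ f.natDegree = n)
          (fun f => ∀ i, Ideal.Quotient.mk (Ideal.span {Q i}) f ∈ T i)).symm
      simp only [and_assoc]
    · intro f
      obtain ⟨g, rfl⟩ := (monicEquivDegreeLT (R := F) n).symm.surjective f
      rw [Equiv.apply_symm_apply]
      simp only [Set.mem_ofPred_eq, hφa]
      refine forall_congr' fun i => ?_
      rw [← map_add, add_comm]
      rfl
  have e2 : Nat.card {x : ∀ i, F[X] ⧸ Ideal.span {Q i} |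
      ∀ i, x i + Ideal.Quotient.mk (Ideal.span {Q i}) (X ^ n) ∈ T i} = ∏ i, Nat.card (T i) := by
    rw [← Nat.card_pi]
    apply Nat.card_congr
    refine Equiv.trans ?_ (Equiv.subtypePiEquivPi (p := fun i x => x ∈ T i))
    refine Equiv.subtypeEquiv (Equiv.addRight
      (fun i => Ideal.Quotient.mk (Ideal.span {Q i}) (X ^ n))) ?_
    intro x
    rfl
  rw [e1, h, e2]

lemma card_monic (n : ℕ) :
    Nat.card {f : F[X] // f.Monic ∧ f.natDegree = n} = Fintype.card F ^ n := by
  rw [Nat.card_congr (monicEquivDegreeLT (R := F) n), card_degreeLT]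

lemma finite_monic (n : ℕ) : {f : F[X] | f.Monic ∧ f.natDegree = n}.Finite :=
  Finite.of_equiv _ (monicEquivDegreeLT (R := F) n).symm

lemma finite_le (m : ℕ) : {f : F[X] | f.natDegree ≤ m}.Finite := by
  refine Set.Finite.subset (s := (degreeLT F (m+1) : Set F[X])) (finite_degreeLT (m+1)) ?_
  intro f hf
  simp only [SetLike.mem_coe, mem_degreeLT]
  exact degree_le_natDegree.trans_lt (by exact_mod_cast Nat.lt_succ_of_le hf)

lemma ncard_le (m : ℕ) : {f : F[X] | f.natDegree ≤ m}.ncard ≤ Fintype.card F ^ (m+1) := by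
  rw [← card_degreeLT (F := F) (m+1)]
  refine Set.ncard_le_ncard (t := (degreeLT F (m+1) : Set F[X])) ?_ (finite_degreeLT (m+1))
  intro f hf
  simp only [SetLike.mem_coe, mem_degreeLT]
  exact degree_le_natDegree.trans_lt (by exact_mod_cast Nat.lt_succ_of_le hf)

lemma two_le_q : (2 : ℝ) ≤ Fintype.card F := by
  exact_mod_cast Fintype.one_lt_card (α := F)

lemma tail (k : ℕ) (hk : 2 ≤ k) (m : ℕ) (U : Finset F[X])
    (hU : ∀ P ∈ U, P.Monic ∧ m < P.natDegree) :
    ∑ P ∈ U, 1 / (Fintype.card F : ℝ) ^ (k * P.natDegree) ≤ 1 / (Fintype.card F : ℝ) ^ m := by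
  have hq := two_le_q (F := F)
  set q : ℝ := (Fintype.card F : ℝ) with hqdef
  have hq0 : 0 < q := by linarith
  set N := U.sup natDegree + 1
  have hmaps : ∀ P ∈ U, P.natDegree ∈ Finset.Ico (m+1) N := by
    intro P hP
    rw [Finset.mem_Ico]
    exact ⟨(hU P hP).2, Nat.lt_succ_of_le (Finset.le_sup (f := natDegree) hP)⟩
  rw [← Finset.sum_fiberwise_of_maps_to hmaps]
  calc _ ≤ ∑ d ∈ Finset.Ico (m+1) N, (1/q)^d := by
        apply Finset.sum_le_sum
        intro d _
        have h1 : ∑ P ∈ U with P.natDegree = d, 1 / q ^ (k * P.natDegree)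
            = (U.filter (fun P => P.natDegree = d)).card * (1 / q ^ (k * d)) := by
          rw [← nsmul_eq_mul]
          apply Finset.sum_eq_card_nsmul
          intro P hP
          rw [(Finset.mem_filter.1 hP).2]
        rw [h1]
        have h2 : ((U.filter (fun P => P.natDegree = d)).card : ℝ) ≤ q ^ d := by
          rw [hqdef]
          have : (U.filter (fun P => P.natDegree = d)).card ≤ Fintype.card F ^ d := by
            rw [← card_monic (F := F) d, ← Set.ncard_coe_finset]
            refine Set.ncard_le_ncard (t := {f : F[X] | f.Monic ∧ f.natDegree = d}) ?_
              (finite_monic d)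
            intro P hP
            have := Finset.mem_filter.1 (Finset.mem_coe.1 hP)
            exact ⟨(hU P this.1).1, this.2⟩
          exact_mod_cast this
        calc _ ≤ q ^ d * (1 / q ^ (2 * d)) := by
              gcongr
              linarith
          _ = (1/q)^d := by
              rw [two_mul, pow_add, one_div_pow]; field_simp
    _ ≤ (1/q)^(m+1) / (1 - 1/q) := by
        apply geom_sum_Ico_le_of_lt_one (by positivity)
        rw [div_lt_one hq0]; linarith
    _ ≤ 1 / q^m := by
        have h3 : 1 - 1/q = (q-1)/q := by field_simp
        have h4 : (1/q)^(m+1) / (1 - 1/q) = 1/q^m * (1/(q-1)) := by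
          have : q - 1 ≠ 0 := by linarith
          rw [h3, pow_succ, one_div_pow]; field_simp
        rw [h4]
        have : 1/(q-1) ≤ 1 := by
          rw [div_le_one] <;> linarith
        exact mul_le_of_le_one_right (by positivity) this

lemma count_dvd (Q : F[X]) (hQ : Q.Monic) (b : F) (n : ℕ) (hn : 1 ≤ n) :
    (Nat.card {f : F[X] // f.Monic ∧ f.natDegree = n ∧ Q ∣ f + C b} : ℝ) ≤
      (Fintype.card F : ℝ) ^ n * (1 / (Fintype.card F : ℝ) ^ Q.natDegree) := by
  have hq := two_le_q (F := F)
  by_cases h : Q.natDegree ≤ n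
  · have := count (ι := Unit) (fun _ => Q) (fun _ => hQ)
      (fun i j hij => (hij rfl).elim) n (by simpa using h)
      (fun _ => {- Ideal.Quotient.mk (Ideal.span {Q}) (C b)})
    simp only [Finset.univ_unique, Finset.prod_singleton, forall_const, Set.mem_singleton_iff,
      Nat.card_eq_fintype_card (α := ({- Ideal.Quotient.mk (Ideal.span {Q}) (C b)} : Set _)),
      Fintype.card_unique, mul_one] at this
    have e : ∀ f : F[X], Ideal.Quotient.mk (Ideal.span {Q}) f =
        - Ideal.Quotient.mk (Ideal.span {Q}) (C b) ↔ Q ∣ f + C b := by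
      intro f
      rw [eq_neg_iff_add_eq_zero, ← map_add, Ideal.Quotient.eq_zero_iff_mem,
        Ideal.mem_span_singleton]
    simp only [e] at this
    rw [mul_one_div, le_div_iff₀ (by positivity)]
    exact_mod_cast this.le
  · have : IsEmpty {f : F[X] // f.Monic ∧ f.natDegree = n ∧ Q ∣ f + C b} := by
      constructor
      rintro ⟨f, hf, hd, hdvd⟩
      have h1 : (f + C b).natDegree = n := by rw [natDegree_add_C, hd]
      have h2 := natDegree_le_of_dvd hdvd (by
        intro h0
        rw [h0] at h1
        simp at h1
        omega)
      omega
    rw [Nat.card_of_isEmpty]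
    simp only [Nat.cast_zero]
    positivity

lemma card_T {P : F[X]} (hP : P.Monic) (hi : Irreducible P) {a : F} (ha : a ≠ 0) (k : ℕ)
    (hk : 2 ≤ k) :
    (Nat.card {t : F[X] ⧸ Ideal.span {P ^ k} |
      t ≠ 0 ∧ t + Ideal.Quotient.mk _ (C a) ≠ 0} : ℝ) =
      (Fintype.card F : ℝ) ^ (k * P.natDegree) - 2 := by
  have := finite_quot (hP.pow k)
  have hs : {t : F[X] ⧸ Ideal.span {P ^ k} | t ≠ 0 ∧ t + Ideal.Quotient.mk _ (C a) ≠ 0} =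
      {0, - Ideal.Quotient.mk _ (C a)}ᶜ := by
    ext t
    simp [eq_neg_iff_add_eq_zero]
  have hne : (0 : F[X] ⧸ Ideal.span {P ^ k}) ≠ - Ideal.Quotient.mk _ (C a) := by
    intro h
    rw [eq_comm, neg_eq_zero, Ideal.Quotient.eq_zero_iff_mem, Ideal.mem_span_singleton] at h
    have h1 : IsUnit (C a) := isUnit_C.2 ha.isUnit
    have h2 := isUnit_of_dvd_unit ((dvd_pow_self P (by omega)).trans h) h1
    exact hi.not_isUnit h2
  have h := Set.ncard_add_ncard_compl ({0, - Ideal.Quotient.mk _ (C a)} :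
    Set (F[X] ⧸ Ideal.span {P ^ k}))
  rw [Set.ncard_pair hne, card_quot (hP.pow k), hP.natDegree_pow] at h
  rw [hs, Nat.card_coe_set_eq, eq_sub_iff_add_eq']
  exact_mod_cast h

lemma count_S {a : F} (ha : a ≠ 0) (k : ℕ) (hk : 2 ≤ k) (S : Finset F[X])
    (hS : ∀ P ∈ S, P.Monic ∧ Irreducible P) (n : ℕ) (hn : ∑ P ∈ S, k * P.natDegree ≤ n) :
    (Nat.card {f : F[X] // f.Monic ∧ f.natDegree = n ∧
      ∀ P ∈ S, ¬ P ^ k ∣ f ∧ ¬ P ^ k ∣ f + C a} : ℝ) =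
      (Fintype.card F : ℝ) ^ n * ∏ P ∈ S, (1 - 2 / (Fintype.card F : ℝ) ^ (k * P.natDegree)) := by
  have hq := two_le_q (F := F)
  have hq0 : (0 : ℝ) < Fintype.card F := by linarith
  have h := count (ι := S) (fun P => P.1 ^ k) (fun P => (hS P.1 P.2).1.pow k)
    (by
      intro P R hPR
      apply IsCoprime.pow
      refine (hS P.1 P.2).2.coprime_iff_not_dvd.2 fun h => ?_
      · apply hPR
        apply Subtype.ext
        exact eq_of_monic_of_associated (hS P.1 P.2).1 (hS R.1 R.2).1
          ((hS P.1 P.2).2.associated_of_dvd (hS R.1 R.2).2 h)) n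
    (by
      rw [Finset.sum_coe_sort S (fun P => (P ^ k).natDegree)]
      refine le_trans (le_of_eq (Finset.sum_congr rfl fun P hP => ?_)) hn
      rw [(hS P hP).1.natDegree_pow])
    (fun P => {t | t ≠ 0 ∧ t + Ideal.Quotient.mk _ (C a) ≠ 0})
  have h' := congrArg (Nat.cast (R := ℝ)) h
  push_cast at h'
  have hT : ∏ P : S, (Nat.card {t : F[X] ⧸ Ideal.span {P.1 ^ k} |
      t ≠ 0 ∧ t + Ideal.Quotient.mk _ (C a) ≠ 0} : ℝ) =
      ∏ P : S, ((Fintype.card F : ℝ) ^ (k * P.1.natDegree) - 2) :=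
    Finset.prod_congr rfl (fun P _ => card_T (hS P.1 P.2).1 (hS P.1 P.2).2 ha k hk)
  have hD : ∏ P : S, (Fintype.card F : ℝ) ^ (P.1 ^ k).natDegree =
      ∏ P : S, (Fintype.card F : ℝ) ^ (k * P.1.natDegree) :=
    Finset.prod_congr rfl (fun P _ => by rw [(hS P.1 P.2).1.natDegree_pow])
  rw [hT, hD,
    Finset.prod_coe_sort S (fun P => (Fintype.card F : ℝ) ^ (k * P.natDegree)),
    Finset.prod_coe_sort S (fun P => (Fintype.card F : ℝ) ^ (k * P.natDegree) - 2)] at h'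
  have e : ∀ f : F[X], (∀ P : S, Ideal.Quotient.mk (Ideal.span {P.1 ^ k}) f ∈
      {t : F[X] ⧸ Ideal.span {P.1 ^ k} | t ≠ 0 ∧ t + Ideal.Quotient.mk _ (C a) ≠ 0}) ↔
      ∀ P ∈ S, ¬ P ^ k ∣ f ∧ ¬ P ^ k ∣ f + C a := by
    intro f
    rw [Subtype.forall]
    refine forall₂_congr fun P hP => ?_
    rw [Set.mem_ofPred_eq, ← map_add, Ne, Ne, Ideal.Quotient.eq_zero_iff_mem,
      Ideal.Quotient.eq_zero_iff_mem, Ideal.mem_span_singleton, Ideal.mem_span_singleton]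
  simp only [e] at h'
  have hpos : (0 : ℝ) < ∏ P ∈ S, (Fintype.card F : ℝ) ^ (k * P.natDegree) :=
    Finset.prod_pos fun P _ => by positivity
  have h3 : (∏ P ∈ S, (1 - 2 / (Fintype.card F : ℝ) ^ (k * P.natDegree))) *
      ∏ P ∈ S, (Fintype.card F : ℝ) ^ (k * P.natDegree) =
      ∏ P ∈ S, ((Fintype.card F : ℝ) ^ (k * P.natDegree) - 2) := by
    rw [← Finset.prod_mul_distrib]
    refine Finset.prod_congr rfl fun P _ => ?_
    field_simp
  apply mul_right_cancel₀ hpos.ne'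
  rw [h', mul_assoc, h3]

/-- Monic irreducibles of degree at most `m`. -/
noncomputable def primes (F : Type*) [Field F] [Fintype F] (m : ℕ) : Finset F[X] :=
  (finite_le (F := F) m).toFinset.filter fun P => P.Monic ∧ Irreducible P

lemma mem_primes {m : ℕ} {P : F[X]} :
    P ∈ primes F m ↔ P.natDegree ≤ m ∧ P.Monic ∧ Irreducible P := by
  simp [primes]

lemma kfree_iff (k : ℕ) (f : F[X]) :
    IsKFree k f ↔ ∀ P : F[X], P.Monic → Irreducible P → ¬ P ^ k ∣ f := by
  constructor
  · intro h P _ hi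
    exact h P hi
  · intro h P hi hd
    have ha : Associated (normalize P) P := normalize_associated P
    exact h (normalize P) (monic_normalize hi.ne_zero) (ha.symm.irreducible hi)
      ((ha.pow_pow (n := k)).dvd.trans hd)

lemma sieve {a : F} (ha : a ≠ 0) (k : ℕ) (hk : 2 ≤ k) (m n : ℕ) (hn1 : 1 ≤ n)
    (hn : ∑ P ∈ primes F m, k * P.natDegree ≤ n) :
    |(Nat.card {f : F[X] // f.Monic ∧ f.natDegree = n ∧ IsKFree k f ∧ IsKFree k (f + C a)} : ℝ) /
      (Fintype.card F : ℝ) ^ n -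
      ∏ P ∈ primes F m, (1 - 2 / (Fintype.card F : ℝ) ^ (k * P.natDegree))| ≤
      2 * (1 / (Fintype.card F : ℝ) ^ m) := by
  have hq := two_le_q (F := F)
  have hq0 : (0 : ℝ) < Fintype.card F := by linarith
  have hqn : (0 : ℝ) < (Fintype.card F : ℝ) ^ n := by positivity
  have hS := count_S ha k hk (primes F m) (fun P hP => (mem_primes.1 hP).2) n hn
  set G : Set F[X] := {f | f.Monic ∧ f.natDegree = n ∧ IsKFree k f ∧ IsKFree k (f + C a)} with hG
  set A : Set F[X] := {f | f.Monic ∧ f.natDegree = n ∧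
      ∀ P ∈ primes F m, ¬ P ^ k ∣ f ∧ ¬ P ^ k ∣ f + C a} with hA
  let D : F → F[X] → Set F[X] := fun b P => {f | f.Monic ∧ f.natDegree = n ∧ P ^ k ∣ f + C b}
  set U : Finset F[X] := (primes F n).filter (fun P => m < P.natDegree) with hU
  have hAf : A.Finite := (finite_monic n).subset fun f hf => ⟨hf.1, hf.2.1⟩
  have hGf : G.Finite := (finite_monic n).subset fun f hf => ⟨hf.1, hf.2.1⟩
  have hDf : ∀ b P, (D b P).Finite := fun b P =>
    (finite_monic n).subset fun f hf => ⟨hf.1, hf.2.1⟩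
  have hGA : G ⊆ A := by
    rintro f ⟨h1, h2, h3, h4⟩
    exact ⟨h1, h2, fun P hP => ⟨h3 P (mem_primes.1 hP).2.2, h4 P (mem_primes.1 hP).2.2⟩⟩
  have hAG : A ⊆ G ∪ ⋃ P ∈ U, (D 0 P ∪ D a P) := by
    rintro f ⟨h1, h2, h3⟩
    by_contra hcon
    rw [Set.mem_union, not_or] at hcon
    obtain ⟨hc1, hc2⟩ := hcon
    have main : ∀ b : F, (b = 0 ∨ b = a) → ∀ P : F[X], P.Monic → Irreducible P →
        ¬ P ^ k ∣ f + C b := by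
      intro b hb P hP hi hd
      have hdeg : (f + C b).natDegree = n := by rw [natDegree_add_C, h2]
      have hne : f + C b ≠ 0 := by
        intro h0
        rw [h0] at hdeg
        simp at hdeg
        omega
      by_cases hm : P.natDegree ≤ m
      · have := h3 P (mem_primes.2 ⟨hm, hP, hi⟩)
        rcases hb with rfl | rfl
        · exact this.1 (by simpa using hd)
        · exact this.2 hd
      · have hle : P.natDegree ≤ n := by
          rw [← hdeg]
          exact natDegree_le_of_dvd ((dvd_pow_self P (by omega)).trans hd) hne
        apply hc2
        simp only [Set.mem_iUnion]
        refine ⟨P, Finset.mem_filter.2 ⟨mem_primes.2 ⟨hle, hP, hi⟩, by omega⟩, ?_⟩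
        rcases hb with rfl | rfl
        · exact Or.inl ⟨h1, h2, hd⟩
        · exact Or.inr ⟨h1, h2, hd⟩
    apply hc1
    refine ⟨h1, h2, (kfree_iff k f).2 fun P hP hi => ?_, (kfree_iff k _).2 (main a (Or.inr rfl))⟩
    simpa using main 0 (Or.inl rfl) P hP hi
  have hfin : (⋃ P ∈ U, (D 0 P ∪ D a P)).Finite :=
    Set.Finite.biUnion U.finite_toSet fun P _ => (hDf 0 P).union (hDf a P)
  have c1 : (G.ncard : ℝ) ≤ A.ncard := by
    exact_mod_cast Set.ncard_le_ncard hGA hAf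
  have c2 : (A.ncard : ℝ) ≤ G.ncard + ∑ P ∈ U, (((D 0 P).ncard : ℝ) + (D a P).ncard) := by
    have e1 : A.ncard ≤ G.ncard + (⋃ P ∈ U, (D 0 P ∪ D a P)).ncard :=
      (Set.ncard_le_ncard hAG (hGf.union hfin)).trans (Set.ncard_union_le _ _)
    have e2 : (⋃ P ∈ U, (D 0 P ∪ D a P)).ncard ≤ ∑ P ∈ U, ((D 0 P).ncard + (D a P).ncard) :=
      (Finset.set_ncard_biUnion_le U _).trans
        (Finset.sum_le_sum fun P _ => Set.ncard_union_le _ _)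
    exact_mod_cast e1.trans (Nat.add_le_add_left e2 _)
  have c3 : ∑ P ∈ U, (((D 0 P).ncard : ℝ) + (D a P).ncard) ≤
      (Fintype.card F : ℝ) ^ n * (2 * (1 / (Fintype.card F : ℝ) ^ m)) := by
    have t := tail k hk m U fun P hP =>
      ⟨(mem_primes.1 (Finset.mem_filter.1 hP).1).2.1, (Finset.mem_filter.1 hP).2⟩
    calc _ ≤ ∑ P ∈ U, (Fintype.card F : ℝ) ^ n * 2 *
          (1 / (Fintype.card F : ℝ) ^ (k * P.natDegree)) := by
          refine Finset.sum_le_sum fun P hP => ?_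
          have hPm := (mem_primes.1 (Finset.mem_filter.1 hP).1).2.1
          have d0 := count_dvd (P ^ k) (hPm.pow k) 0 n hn1
          have da := count_dvd (P ^ k) (hPm.pow k) a n hn1
          rw [hPm.natDegree_pow] at d0 da
          have d0' : ((D 0 P).ncard : ℝ) ≤ _ := d0
          have da' : ((D a P).ncard : ℝ) ≤ _ := da
          linarith
      _ ≤ _ := by
          rw [← Finset.mul_sum, ← mul_assoc]
          gcongr
  have hS' : (A.ncard : ℝ) = _ := hS
  change |(G.ncard : ℝ) / _ - _| ≤ _
  rw [abs_le]
  rw [hS'] at c1 c2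
  constructor
  · rw [le_sub_iff_add_le, le_div_iff₀ hqn]
    linarith
  · have : (G.ncard : ℝ) / (Fintype.card F : ℝ) ^ n ≤
        ∏ P ∈ primes F m, (1 - 2 / (Fintype.card F : ℝ) ^ (k * P.natDegree)) := by
      rw [div_le_iff₀ hqn]; linarith
    have : (0 : ℝ) ≤ 2 * (1 / (Fintype.card F : ℝ) ^ m) := by positivity
    linarith

lemma weier {ι : Type*} (S : Finset ι) (x : ι → ℝ) (h0 : ∀ i, 0 ≤ x i) (h1 : ∀ i, x i ≤ 1) :
    1 - ∑ i ∈ S, x i ≤ ∏ i ∈ S, (1 - x i) ∧ 0 ≤ ∏ i ∈ S, (1 - x i) ∧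
      ∏ i ∈ S, (1 - x i) ≤ 1 := by
  induction S using Finset.induction_on with
  | empty => simp
  | insert i S hi ih =>
    rw [Finset.sum_insert hi, Finset.prod_insert hi]
    obtain ⟨a1, a2, a3⟩ := ih
    have := h0 i
    have := h1 i
    refine ⟨?_, ?_, ?_⟩ <;> nlinarith

lemma product (k : ℕ) (hk : 2 ≤ k) (m : ℕ) :
    |∏ P ∈ primes F m, (1 - 2 / (Fintype.card F : ℝ) ^ (k * P.natDegree)) -
      ∏' P : {P : F[X] // P.Monic ∧ Irreducible P},
          (1 - 2 / (Fintype.card F : ℝ) ^ (k * P.1.natDegree))| ≤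
      2 * (1 / (Fintype.card F : ℝ) ^ m) := by
  have hq := two_le_q (F := F)
  have hq0 : (0 : ℝ) < Fintype.card F := by linarith
  set x : {P : F[X] // P.Monic ∧ Irreducible P} → ℝ :=
    fun P => 2 / (Fintype.card F : ℝ) ^ (k * P.1.natDegree) with hx
  have hx0 : ∀ P, 0 ≤ x P := fun P => by positivity
  have hx1 : ∀ P, x P ≤ 1 := by
    intro P
    rw [hx]
    simp only
    rw [div_le_one (by positivity)]
    refine hq.trans (le_self_pow₀ (by linarith) ?_)
    have := P.2.2.natDegree_pos
    positivity
  have htail : ∀ (j : ℕ) (U : Finset {P : F[X] // P.Monic ∧ Irreducible P}),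
      (∀ P ∈ U, j < P.1.natDegree) → ∑ P ∈ U, x P ≤ 2 * (1 / (Fintype.card F : ℝ) ^ j) := by
    intro j U hU
    have t := tail k hk j (U.map (Function.Embedding.subtype _)) (by
      intro P hP
      obtain ⟨R, hR, rfl⟩ := Finset.mem_map.1 hP
      exact ⟨R.2.1, hU R hR⟩)
    rw [Finset.sum_map] at t
    calc ∑ P ∈ U, x P = 2 * ∑ P ∈ U, 1 / (Fintype.card F : ℝ) ^ (k * P.1.natDegree) := by
          rw [Finset.mul_sum]
          exact Finset.sum_congr rfl fun P _ => by rw [hx]; simp only; ring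
      _ ≤ _ := by
          gcongr
          exact t
  have hsum : Summable x := summable_of_sum_le hx0 (c := 2 * (1 / (Fintype.card F : ℝ) ^ 0))
    fun U => htail 0 U fun P _ => P.2.2.natDegree_pos
  have hmul : Multipliable fun P => 1 - x P := by
    have := multipliable_one_add_of_summable (f := fun P => - x P) (by simpa using hsum.norm)
    simpa [sub_eq_add_neg] using this
  have hprod := hmul.hasProd
  set S : Finset {P : F[X] // P.Monic ∧ Irreducible P} := (primes F m).subtype _ with hS
  have hSe : ∏ P ∈ primes F m, (1 - 2 / (Fintype.card F : ℝ) ^ (k * P.natDegree)) =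
      ∏ P ∈ S, (1 - x P) := by
    rw [hS, ← Finset.prod_subtype_of_mem (p := fun P : F[X] => P.Monic ∧ Irreducible P)
      (fun P => (1 - 2 / (Fintype.card F : ℝ) ^ (k * P.natDegree)))]
    intro P hP
    exact (mem_primes.1 hP).2
  rw [hSe]
  have hlim : Tendsto (fun V : Finset {P : F[X] // P.Monic ∧ Irreducible P} =>
      |∏ P ∈ S, (1 - x P) - ∏ P ∈ V, (1 - x P)|) atTop
      (nhds |∏ P ∈ S, (1 - x P) - ∏' P, (1 - x P)|) :=
    (tendsto_const_nhds.sub hprod).abs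
  refine le_of_tendsto hlim ?_
  filter_upwards [eventually_ge_atTop S] with V hV
  rw [← Finset.prod_sdiff hV]
  obtain ⟨a1, a2, a3⟩ := weier (V \ S) x hx0 hx1
  obtain ⟨b1, b2, b3⟩ := weier S x hx0 hx1
  have ht := htail m (V \ S) (by
    intro P hP
    by_contra hcon
    refine (Finset.mem_sdiff.1 hP).2 ?_
    rw [hS, Finset.mem_subtype]
    exact mem_primes.2 ⟨by omega, P.2⟩)
  have hs0 : 0 ≤ ∑ P ∈ V \ S, x P := Finset.sum_nonneg fun P _ => hx0 P
  rw [abs_le]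
  constructor <;> nlinarith

lemma degsum (k m : ℕ) :
    ∑ P ∈ primes F m, k * P.natDegree ≤ k * m * Fintype.card F ^ (m + 1) := by
  calc _ ≤ ∑ P ∈ primes F m, k * m :=
        Finset.sum_le_sum fun P hP => Nat.mul_le_mul_left _ (mem_primes.1 hP).1
    _ = (primes F m).card * (k * m) := by simp
    _ ≤ Fintype.card F ^ (m + 1) * (k * m) := by
        apply Nat.mul_le_mul_right
        refine le_trans ?_ (ncard_le (F := F) m)
        rw [← Set.ncard_coe_finset]
        exact Set.ncard_le_ncard (fun P hP => (mem_primes.1 (Finset.mem_coe.1 hP)).1) (finite_le m)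
    _ = _ := by ring

lemma total {a : F} (ha : a ≠ 0) (k : ℕ) (hk : 2 ≤ k) (m n : ℕ) (hn1 : 1 ≤ n)
    (hn : k * m * Fintype.card F ^ (m + 1) ≤ n) :
    |(Nat.card {f : F[X] // f.Monic ∧ f.natDegree = n ∧ IsKFree k f ∧ IsKFree k (f + C a)} : ℝ) /
      (Fintype.card F : ℝ) ^ n -
      ∏' P : {P : F[X] // P.Monic ∧ Irreducible P},
          (1 - 2 / (Fintype.card F : ℝ) ^ (k * P.1.natDegree))| ≤
      4 * (1 / (Fintype.card F : ℝ) ^ m) := by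
  have h1 := sieve ha k hk m n hn1 ((degsum k m).trans hn)
  have h2 := product (F := F) k hk m
  refine (abs_sub_le _ _ _).trans ((add_le_add h1 h2).trans (le_of_eq ?_))
  ring

/-- Choice of the sieving level. -/
lemma choose_level (q k : ℕ) (hq : 2 ≤ q) (B : ℝ) (hB0 : 0 < B) (hB1 : B < 1) :
    ∀ᶠ n : ℕ in atTop, ∃ m : ℕ, k * m * q ^ (m + 1) ≤ n ∧
      1 / (q : ℝ) ^ m ≤ q * (n : ℝ) ^ (-B) := by
  have hq' : (2 : ℝ) ≤ q := by exact_mod_cast hq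
  have hlogq : 0 < Real.log q := Real.log_pos (by linarith)
  have hlo := (isLittleO_log_rpow_atTop (sub_pos.2 hB1)).bound
    (c := Real.log q / (k * q + 1)) (by positivity)
  have hlo' := tendsto_natCast_atTop_atTop (R := ℝ) |>.eventually hlo
  filter_upwards [hlo', eventually_ge_atTop 1] with n hn hn1
  have hn1' : (1 : ℝ) ≤ n := by exact_mod_cast hn1
  have hn0 : (0 : ℝ) < n := by linarith
  have hnB : 1 ≤ (n : ℝ) ^ B := Real.one_le_rpow hn1' hB0.le
  set y := (n : ℝ) ^ B with hy
  obtain ⟨m, hm1, hm2⟩ := exists_nat_pow_near hnB (show (1 : ℝ) < q by linarith)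
  refine ⟨m, ?_, ?_⟩
  · have hlogn : 0 ≤ Real.log n := Real.log_nonneg hn1'
    rw [Real.norm_of_nonneg hlogn, Real.norm_of_nonneg (by positivity)] at hn
    have h1 : (m : ℝ) * Real.log q ≤ Real.log n := by
      have := Real.log_le_log (by positivity) hm1
      rw [Real.log_pow, hy, Real.log_rpow hn0] at this
      nlinarith
    have h2 : (m : ℝ) * (k * q) ≤ (n : ℝ) ^ (1 - B) := by
      have h3 : (m : ℝ) * Real.log q ≤ Real.log q / (k * q + 1) * (n : ℝ) ^ (1 - B) := h1.trans hn
      have h4 : (m : ℝ) ≤ (n : ℝ) ^ (1 - B) / (k * q + 1) := by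
        rw [← mul_le_mul_iff_left₀ hlogq]
        refine h3.trans (le_of_eq ?_)
        ring
      rw [le_div_iff₀ (by positivity)] at h4
      have : (0 : ℝ) ≤ m := by positivity
      linarith
    have h5 : (k * m * q ^ (m + 1) : ℝ) ≤ n := by
      calc (k * m * q ^ (m + 1) : ℝ) = (m * (k * q)) * q ^ m := by ring
        _ ≤ (n : ℝ) ^ (1 - B) * y := by gcongr
        _ = n := by rw [hy, ← Real.rpow_add hn0]; simp
    exact_mod_cast h5
  · rw [Real.rpow_neg hn0.le, ← hy, ← div_eq_mul_inv, div_le_div_iff₀ (by positivity) (by positivity),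
      one_mul, ← pow_succ']
    exact hm2.le

end KFree

/-- For a fixed `a ∈ 𝔽_q^*` and `k ≥ 2`, the density of monic `f` of degree `n` with
`f` and `f + a` both `k`-free is
`∏_P (1 - 2 q^{-k deg P}) + O(n^{-B})` for every `0 < B < 1`. -/
theorem kfree_correlation (Fq : Type*) [Field Fq] [Fintype Fq]
    (a : Fq) (ha : a ≠ 0) (k : ℕ) (hk : 2 ≤ k) (B : ℝ) (hB0 : 0 < B) (hB1 : B < 1) :
    (fun n : ℕ =>
        (Nat.card {f : Polynomial Fq // f.Monic ∧ f.natDegree = n ∧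
            IsKFree k f ∧ IsKFree k (f + Polynomial.C a)} : ℝ) /
          (Fintype.card Fq : ℝ) ^ n -
        ∏' P : {P : Polynomial Fq // P.Monic ∧ Irreducible P},
          (1 - 2 / (Fintype.card Fq : ℝ) ^ (k * P.1.natDegree)))
      =O[atTop] (fun n : ℕ => (n : ℝ) ^ (-B)) := by
  refine IsBigO.of_bound (4 * Fintype.card Fq) ?_
  filter_upwards [KFree.choose_level (Fintype.card Fq) k Fintype.one_lt_card B hB0 hB1,
    eventually_ge_atTop 1] with n hn hn1
  obtain ⟨m, h1, h2⟩ := hn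
  rw [Real.norm_eq_abs, Real.norm_of_nonneg (by positivity), mul_assoc]
  refine (KFree.total ha k hk m n hn1 h1).trans ?_
  gcongr
end
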